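/- arXiv:1003.1849 — 3 statements merged into one kernel-verified Lean document; each statement's English description precedes it below -/
import Mathlib

section
/- Let α ∈ ℝ, k ∈ V, γ ∈ V*, and let K ∈ End(V) be g-skew (g(Kv,w) = −g(v,Kw) for all v,w). Define s ∈ End(W) by s(a,v,b) := (−α·a + γ(v), a·k + K(v) − b·γ^♯, α·b − g(k,v)). Then s is ĝ-skew, and s∘s = −Id_W if and only if all of the following hold: (i) g(k,k) = 0, g(γ^♯,γ^♯) = 0, K(k) = α·k and K(γ^♯) = −α·γ^♯ (k and γ^♯ are light-like eigenvectors of K); (ii) γ(k) + α² = −1; (iii) K(K(v)) = −v for every v ∈ V with g(k,v) = 0 and γ(v) = 0 (K is an almost complex structure on the orthocomplement of k and γ^♯). (This is the pointwise linear-algebra content of Lemma 4.5: the components (γ,−α,K,k) of an adjoint tractor with respect to a metric define a complex structure on the standard tractor space precisely under these conditions.) -/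
/-- pointwise content of Lemma 4.5, [L05].
`(V,g)` is a nondegenerate symmetric real bilinear space, `W = ℝ ⊕ V ⊕ ℝ` with the
form `gHat((a,v,b),(a',v',b')) = a·b' + a'·b + g(v,v')`.  Given `α ∈ ℝ`, `k ∈ V`,
`γ ∈ V*` with `g`-dual `gs = γ^♯`, and a `g`-skew endomorphism `K`, the endomorphism
`s(a,v,b) = (−α·a + γ(v), a·k + K(v) − b·γ^♯, α·b − g(k,v))` is `gHat`-skew, and
`s ∘ s = −Id` iff the stated conditions (i), (ii), (iii) hold. -/
theorem qc_fefferman_stmt0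
    {V : Type*} [AddCommGroup V] [Module ℝ V] [FiniteDimensional ℝ V]
    (g : V →ₗ[ℝ] V →ₗ[ℝ] ℝ)
    (hg_symm : ∀ v w : V, g v w = g w v)
    (hg_nondeg : ∀ v : V, (∀ w : V, g v w = 0) → v = 0)
    (α : ℝ) (k : V) (γ : V →ₗ[ℝ] ℝ) (gs : V)
    (hgs : ∀ v : V, g gs v = γ v)
    (K : V →ₗ[ℝ] V)
    (hK : ∀ v w : V, g (K v) w = - g v (K w))
    (gHat : (ℝ × V × ℝ) → (ℝ × V × ℝ) → ℝ)
    (hgHat : ∀ w w' : ℝ × V × ℝ,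
      gHat w w' = w.1 * w'.2.2 + w'.1 * w.2.2 + g w.2.1 w'.2.1)
    (s : (ℝ × V × ℝ) → (ℝ × V × ℝ))
    (hs : ∀ w : ℝ × V × ℝ,
      s w = (-α * w.1 + γ w.2.1,
             w.1 • k + K w.2.1 - w.2.2 • gs,
             α * w.2.2 - g k w.2.1)) :
    (∀ w w' : ℝ × V × ℝ, gHat (s w) w' = - gHat w (s w')) ∧
    ((∀ w : ℝ × V × ℝ, s (s w) = -w) ↔
      ((g k k = 0 ∧ g gs gs = 0 ∧ K k = α • k ∧ K gs = (-α) • gs) ∧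
       (γ k + α ^ 2 = -1) ∧
       (∀ v : V, g k v = 0 → γ v = 0 → K (K v) = -v))) := by
  have hgk : g k gs = γ k := by rw [hg_symm, hgs]
  refine ⟨fun w w' => ?_, fun h => ?_, ?_⟩
  · simp only [hgHat, hs, map_add, map_sub, map_smul, LinearMap.add_apply, LinearMap.sub_apply,
      LinearMap.smul_apply, smul_eq_mul, hgs, hK, hg_symm w.2.1 k, hg_symm w.2.1 gs]
    ring
  · have hk := h (1, 0, 0)
    have hgs' := h (0, 0, 1)
    simp [hs, Prod.ext_iff] at hk hgs'
    obtain ⟨hk1, hk2, hk3⟩ := hk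
    obtain ⟨hg1, hg2, -⟩ := hgs'
    refine ⟨⟨hk3, by rw [hgs]; exact hg1, ?_, ?_⟩, by linarith, fun v hkv hγv => ?_⟩
    · linear_combination (norm := module) hk2
    · linear_combination (norm := module) -hg2
    · have hv := congrArg (fun w => w.2.1) (h (0, v, 0))
      simpa [hs, hkv, hγv] using hv
  · rintro ⟨⟨hkk, hgg, hKk, hKgs⟩, hα, hJ⟩ ⟨a, v, b⟩
    have hγgs : γ gs = 0 := by rw [← hgs, hgg]
    have hγK : γ (K v) = α * γ v := by
      rw [← hgs, ← neg_eq_iff_eq_neg.mpr (hK gs v), hKgs]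
      simp [hgs]
    have hgK : g k (K v) = -α * g k v := by
      rw [← neg_eq_iff_eq_neg.mpr (hK k v), hKk]
      simp
    have hγk : γ k ≠ 0 := by nlinarith [sq_nonneg α]
    have hK2 : K (K v) = -v - γ v • k - g k v • gs := by
      have hu := hJ (v - (γ v / γ k) • k - (g k v / γ k) • gs)
        (by simp [hkk, hgk, hγk]) (by simp [hγgs, hγk])
      simp only [map_sub, map_smul, hKk, hKgs] at hu
      have hx : γ v / γ k * (α ^ 2 + 1) = -γ v := by
        rw [show α ^ 2 + 1 = -γ k by linarith]; field_simp
      have hy : g k v / γ k * (α ^ 2 + 1) = -g k v := by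
        rw [show α ^ 2 + 1 = -γ k by linarith]; field_simp
      have hx' : (γ v / γ k * (α ^ 2 + 1)) • k = (-γ v) • k := by rw [hx]
      have hy' : (g k v / γ k * (α ^ 2 + 1)) • gs = (-g k v) • gs := by rw [hy]
      linear_combination (norm := module) hu + hx' + hy'
    rw [hs, hs]
    refine Prod.ext ?_ (Prod.ext ?_ ?_)
    · simp only [map_add, map_sub, map_smul, smul_eq_mul, hγK, hγgs, Prod.fst_neg]
      linear_combination a * hα
    · simp only [map_add, map_sub, map_smul, hKk, hKgs, hK2, Prod.fst_neg, Prod.snd_neg]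
      module
    · simp only [map_add, map_sub, map_smul, smul_eq_mul, hgK, hgk, hkk, Prod.snd_neg]
      linear_combination b * hα
end

section
/- Let n ≥ 1 and N := n+2. Let v₀ ∈ ℂ^{2N} be a nonzero vector with h(v₀,v₀) = 0, and let ψ ∈ M_{2N}(ℂ) satisfy: (a) ψᵗH + Hψ̄ = 0 (ψ is skew-hermitian with respect to h); (b) ψ(C(x)) = −C(ψ(x)) for all x ∈ ℂ^{2N} (ψ anticommutes with the quaternionic structure); (c) ψ(w) ∈ ℂ·v₀ for every w ∈ ℂ^{2N} with h(w,v₀) = 0. Then ψ = 0. (This is the linear-algebra claim in the proof of Theorem 5.1: an element of su(2n+2,2) lying both in the orthogonal complement of sp(n+1,1) and in the nilradical p^{cr}_+ must vanish.) -/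
open Matrix

noncomputable section

/-- The Gram matrix `Q_{p+1,q+1}` (with 0-based indices): entry `1` at positions
`(i, p+q+1−i)` and `(p+q+1−i, i)` for `0 ≤ i ≤ q`, entry `1` at `(i,i)` for
`q+1 ≤ i ≤ p`, and `0` otherwise. -/
def Qmat (p q : ℕ) : Matrix (Fin (p + q + 2)) (Fin (p + q + 2)) ℝ :=
  Matrix.of fun i j =>
    if ((i : ℕ) + (j : ℕ) = p + q + 1 ∧ ((i : ℕ) ≤ q ∨ (j : ℕ) ≤ q)) then 1
    else if (i = j ∧ q + 1 ≤ (i : ℕ) ∧ (i : ℕ) ≤ p) then 1 else 0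

/-- Index set for `2N × 2N` matrices, `N = n+2`, written in `N+N` block form. -/
abbrev Idx (n : ℕ) := Fin (n + 2) ⊕ Fin (n + 2)

/-- `H = diag(Q_{n+1,1}, Q_{n+1,1})`, as a complex matrix. -/
def Hmat (n : ℕ) : Matrix (Idx n) (Idx n) ℂ :=
  Matrix.fromBlocks ((Qmat n 0).map (Complex.ofReal)) 0 0 ((Qmat n 0).map (Complex.ofReal))

/-- `J = [[0, −I],[I, 0]]`. -/
def Jmat (n : ℕ) : Matrix (Idx n) (Idx n) ℂ :=
  Matrix.fromBlocks 0 (-1) 1 0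

/-- The hermitian form `h(x,y) = xᵗ H ȳ` of signature `(2n+2,2)`. -/
def herm (n : ℕ) (x y : Idx n → ℂ) : ℂ :=
  ∑ i, ∑ j, x i * Hmat n i j * (starRingEnd ℂ) (y j)

/-- The quaternionic structure `C(x) = J·x̄`. -/
def Cmap (n : ℕ) (x : Idx n → ℂ) : Idx n → ℂ :=
  Jmat n *ᵥ fun i => (starRingEnd ℂ) (x i)

/-- The involution exchanging the first and the last index, of which `Qmat n 0` is the
permutation matrix. -/
def swapEnds (n : ℕ) (i : Fin (n + 2)) : Fin (n + 2) :=
  if (i : ℕ) = 0 ∨ (i : ℕ) = n + 1 then i.rev else i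

theorem swapEnds_swapEnds (n : ℕ) (i : Fin (n + 2)) : swapEnds n (swapEnds n i) = i := by
  by_cases h : (i : ℕ) = 0 ∨ (i : ℕ) = n + 1
  · have h' : (i.rev : ℕ) = 0 ∨ (i.rev : ℕ) = n + 1 := by
      rw [Fin.val_rev]
      omega
    rw [swapEnds, swapEnds, if_pos h, if_pos h', Fin.rev_rev]
  · rw [swapEnds, swapEnds, if_neg h, if_neg h]

theorem Qmat_zero_apply (n : ℕ) (i j : Fin (n + 2)) :
    Qmat n 0 i j = if j = swapEnds n i then 1 else 0 := by
  have hi := i.isLt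
  have hj := j.isLt
  unfold Qmat swapEnds
  rw [Matrix.of_apply, ← ite_or]
  refine if_congr ?_ rfl rfl
  split_ifs with h <;> rw [Fin.ext_iff, Fin.ext_iff]
  · rw [Fin.val_rev]
    omega
  · omega

theorem Qmat_zero_mul_self (n : ℕ) : Qmat n 0 * Qmat n 0 = 1 := by
  ext i k
  change ∑ j : Fin (n + 2), Qmat n 0 i j * Qmat n 0 j k = (1 : Matrix (Fin (n + 2)) _ ℝ) i k
  simp only [Qmat_zero_apply, ite_mul, one_mul, zero_mul]
  rw [Finset.sum_ite_eq' Finset.univ (swapEnds n i), if_pos (Finset.mem_univ _),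
    swapEnds_swapEnds, Matrix.one_apply]
  exact if_congr eq_comm rfl rfl

theorem Qmat_zero_transpose (n : ℕ) : (Qmat n 0)ᵀ = Qmat n 0 := by
  ext i j
  change Qmat n 0 j i = Qmat n 0 i j
  rw [Qmat_zero_apply, Qmat_zero_apply]
  refine if_congr ⟨fun h => ?_, fun h => ?_⟩ rfl rfl <;> rw [h, swapEnds_swapEnds]

theorem Hmat_mul_self (n : ℕ) : Hmat n * Hmat n = 1 := by
  have h : (Qmat n 0).map Complex.ofReal * (Qmat n 0).map Complex.ofReal = 1 := by
    have := (Matrix.map_mul (f := Complex.ofRealHom) (L := Qmat n 0) (M := Qmat n 0)).symm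
    rw [Qmat_zero_mul_self] at this
    exact this.trans (Matrix.map_one _ (map_zero _) (map_one _))
  refine (Matrix.fromBlocks_multiply _ _ _ _ _ _ _ _).trans ?_
  rw [h]
  simp [Matrix.fromBlocks_one]

theorem Hmat_transpose (n : ℕ) : (Hmat n)ᵀ = Hmat n := by
  refine (Matrix.fromBlocks_transpose _ _ _ _).trans ?_
  rw [← Matrix.transpose_map, Qmat_zero_transpose]
  simp [Hmat]

theorem Hmat_map_star (n : ℕ) : (Hmat n).map star = Hmat n := by
  ext (i | i) (j | j) <;> simp [Hmat]

theorem Jmat_map_star (n : ℕ) : (Jmat n).map star = Jmat n := by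
  ext (i | i) (j | j) <;> simp [Jmat, Matrix.one_apply, apply_ite]

theorem Jmat_transpose (n : ℕ) : (Jmat n)ᵀ = -Jmat n := by
  simp [Jmat, Matrix.fromBlocks_transpose, Matrix.fromBlocks_neg]

theorem Jmat_mul_self (n : ℕ) : Jmat n * Jmat n = -1 := by
  simp [Jmat, Matrix.fromBlocks_multiply, ← Matrix.fromBlocks_one, Matrix.fromBlocks_neg]

theorem Jmat_mul_Hmat (n : ℕ) : Jmat n * Hmat n = Hmat n * Jmat n := by
  refine (Matrix.fromBlocks_multiply _ _ _ _ _ _ _ _).trans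
    (Eq.trans ?_ (Matrix.fromBlocks_multiply _ _ _ _ _ _ _ _).symm)
  simp

theorem star_mulVec_eq {m : Type*} [Fintype m] (A : Matrix m m ℂ) (x : m → ℂ) :
    star (A *ᵥ x) = A.map star *ᵥ star x := by
  ext i
  simp [Matrix.mulVec, dotProduct]

open scoped ComplexOrder in
theorem dotProduct_star_self_ne_zero {m : Type*} [Fintype m] {v : m → ℂ} (hv : v ≠ 0) :
    v ⬝ᵥ star v ≠ 0 :=
  fun h => hv (dotProduct_self_star_eq_zero.mp h)

theorem herm_eq (n : ℕ) (x y : Idx n → ℂ) : herm n x y = x ⬝ᵥ Hmat n *ᵥ star y := by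
  simp only [herm, dotProduct, Matrix.mulVec, Finset.mul_sum, mul_assoc, Pi.star_apply,
    starRingEnd_apply]

theorem Cmap_eq (n : ℕ) (x : Idx n → ℂ) : Cmap n x = Jmat n *ᵥ star x := rfl

theorem herm_sub_left (n : ℕ) (x y z : Idx n → ℂ) :
    herm n (x - y) z = herm n x z - herm n y z := by
  simp [herm_eq, sub_dotProduct]

theorem herm_neg_left (n : ℕ) (x z : Idx n → ℂ) : herm n (-x) z = -herm n x z := by
  simp [herm_eq]

theorem herm_smul_left (n : ℕ) (c : ℂ) (x z : Idx n → ℂ) :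
    herm n (c • x) z = c * herm n x z := by
  simp [herm_eq]

theorem star_herm (n : ℕ) (x y : Idx n → ℂ) : star (herm n x y) = herm n y x := by
  rw [herm_eq, herm_eq, ← Matrix.star_dotProduct_star, star_mulVec_eq, star_star,
    Hmat_map_star, Matrix.dotProduct_mulVec, ← Matrix.mulVec_transpose, Hmat_transpose]

theorem herm_smul_right (n : ℕ) (c : ℂ) (x z : Idx n → ℂ) :
    herm n x (c • z) = star c * herm n x z := by
  rw [← star_herm, herm_smul_left, star_mul', star_herm]

theorem Cmap_Cmap (n : ℕ) (x : Idx n → ℂ) : Cmap n (Cmap n x) = -x := by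
  rw [Cmap_eq, Cmap_eq, star_mulVec_eq, Jmat_map_star, star_star, Matrix.mulVec_mulVec,
    Jmat_mul_self, Matrix.neg_mulVec, Matrix.one_mulVec]

theorem Cmap_smul (n : ℕ) (c : ℂ) (x : Idx n → ℂ) : Cmap n (c • x) = star c • Cmap n x := by
  rw [Cmap_eq, Cmap_eq, star_smul, Matrix.mulVec_smul]

theorem Cmap_neg (n : ℕ) (x : Idx n → ℂ) : Cmap n (-x) = -Cmap n x := by
  rw [Cmap_eq, Cmap_eq, star_neg, Matrix.mulVec_neg]

theorem herm_Cmap_Cmap (n : ℕ) (x y : Idx n → ℂ) :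
    herm n (Cmap n x) (Cmap n y) = herm n y x := by
  rw [← star_herm n x y, herm_eq, herm_eq, Cmap_eq, Cmap_eq, star_mulVec_eq, star_star,
    Jmat_map_star, Matrix.mulVec_mulVec, ← Jmat_mul_Hmat, dotProduct_comm,
    ← Matrix.mulVec_mulVec, Matrix.dotProduct_mulVec, ← Matrix.mulVec_transpose, Jmat_transpose,
    Matrix.mulVec_mulVec, Matrix.neg_mul, Jmat_mul_self, neg_neg, Matrix.one_mulVec,
    ← Matrix.star_dotProduct_star, star_mulVec_eq, star_star, Hmat_map_star]

theorem herm_Cmap_left (n : ℕ) (x y : Idx n → ℂ) :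
    herm n (Cmap n x) y = -herm n (Cmap n y) x := by
  have h := herm_Cmap_Cmap n (Cmap n y) x
  rw [Cmap_Cmap, herm_neg_left] at h
  rw [← star_herm, ← star_herm n x, ← h, star_neg, neg_neg]

/-- Since `H² = 1`, pairing with `H v` turns `h` into the standard hermitian product. -/
theorem herm_Hmat_mulVec (n : ℕ) (v y : Idx n → ℂ) :
    herm n (Hmat n *ᵥ v) y = v ⬝ᵥ star y := by
  rw [herm_eq, Matrix.dotProduct_mulVec, ← Matrix.mulVec_transpose, Hmat_transpose,
    Matrix.mulVec_mulVec, Hmat_mul_self, Matrix.one_mulVec]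

theorem dotProduct_star_Cmap_self (n : ℕ) (v : Idx n → ℂ) : v ⬝ᵥ star (Cmap n v) = 0 := by
  have h : v ⬝ᵥ Jmat n *ᵥ v = -(v ⬝ᵥ Jmat n *ᵥ v) := by
    conv_lhs => rw [Matrix.dotProduct_mulVec, ← Matrix.mulVec_transpose, Jmat_transpose,
      Matrix.neg_mulVec, neg_dotProduct, dotProduct_comm]
  rw [Cmap_eq, star_mulVec_eq, Jmat_map_star, star_star]
  exact self_eq_neg.mp h

theorem herm_mulVec_add_herm_mulVec (n : ℕ) (ψ : Matrix (Idx n) (Idx n) ℂ)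
    (ha : ψᵀ * Hmat n + Hmat n * ψ.map (starRingEnd ℂ) = 0) (x y : Idx n → ℂ) :
    herm n (ψ *ᵥ x) y + herm n x (ψ *ᵥ y) = 0 := by
  have h : x ⬝ᵥ (ψᵀ * Hmat n + Hmat n * ψ.map (starRingEnd ℂ)) *ᵥ star y = 0 := by
    rw [ha, Matrix.zero_mulVec, dotProduct_zero]
  rw [Matrix.add_mulVec, dotProduct_add, ← Matrix.mulVec_mulVec, ← Matrix.mulVec_mulVec,
    Matrix.dotProduct_mulVec, Matrix.vecMul_transpose] at h
  rw [herm_eq, herm_eq, star_mulVec_eq]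
  exact h

/-- linear-algebra claim in the proof of Theorem 5.1.
If `v₀ ≠ 0` is `h`-null and `ψ` is skew-hermitian w.r.t. `h`, anticommutes with the
quaternionic structure `C`, and maps the `h`-orthocomplement of `v₀` into `ℂ·v₀`,
then `ψ = 0`. -/
theorem qc_fefferman_stmt2 (n : ℕ) (hn : 1 ≤ n)
    (v₀ : Idx n → ℂ) (hv₀ : v₀ ≠ 0) (hnull : herm n v₀ v₀ = 0)
    (ψ : Matrix (Idx n) (Idx n) ℂ)
    (ha : ψᵀ * Hmat n + Hmat n * ψ.map (starRingEnd ℂ) = 0)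
    (hb : ∀ x : Idx n → ℂ, ψ *ᵥ Cmap n x = - Cmap n (ψ *ᵥ x))
    (hc : ∀ w : Idx n → ℂ, herm n w v₀ = 0 → ∃ z : ℂ, ψ *ᵥ w = z • v₀) :
    ψ = 0 := by
  set u := Cmap n v₀ with hu
  set a := Hmat n *ᵥ v₀
  set s := v₀ ⬝ᵥ star v₀ with hs_def
  have hs : s ≠ 0 := dotProduct_star_self_ne_zero hv₀
  have hav : herm n a v₀ = s := herm_Hmat_mulVec n v₀ v₀
  have hau : herm n a u = 0 :=
    (herm_Hmat_mulVec n v₀ u).trans (dotProduct_star_Cmap_self n v₀)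
  have hva : herm n v₀ a = s := by
    rw [← star_herm, hav, hs_def, ← Matrix.star_dotProduct_star, star_star, dotProduct_comm]
  have hua : herm n u a = 0 := by rw [← star_herm, hau, star_zero]
  have hbv : herm n (Cmap n a) v₀ = 0 := by rw [herm_Cmap_left, ← hu, hua, neg_zero]
  have hbu : herm n (Cmap n a) u = s := by rw [hu, herm_Cmap_Cmap, hva]
  -- `ψ` maps the orthocomplement of `u = C v₀` into `ℂ u`.
  have hc' : ∀ w, herm n w u = 0 → ∃ z : ℂ, ψ *ᵥ w = z • u := by
    intro w hw
    have hw' : herm n (Cmap n w) v₀ = 0 := by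
      rw [herm_Cmap_left, ← star_herm, ← hu, hw, star_zero, neg_zero]
    obtain ⟨z, hz⟩ := hc _ hw'
    refine ⟨star z, ?_⟩
    rw [hb] at hz
    rw [hu, ← Cmap_smul, ← hz, Cmap_neg, Cmap_Cmap, neg_neg]
  obtain ⟨z, hz⟩ := hc' a hau
  have hzb : ψ *ᵥ Cmap n a = star z • v₀ := by
    rw [hb, hz, Cmap_smul, hu, Cmap_Cmap, smul_neg, neg_neg]
  have hz0 : z = 0 := by
    have h := herm_mulVec_add_herm_mulVec n ψ ha a (Cmap n a)
    rw [hz, hzb, herm_smul_left, herm_smul_right, star_star, hav, hu, herm_Cmap_Cmap, hav,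
      ← two_mul] at h
    simpa [hs] using h
  rw [hz0, zero_smul] at hz
  rw [hz0, star_zero, zero_smul] at hzb
  have hψ : ∀ w, ψ *ᵥ w = 0 := by
    intro w
    set w' := w - (herm n w v₀ / s) • a - (herm n w u / s) • Cmap n a with hw'
    have hw'v : herm n w' v₀ = 0 := by
      rw [hw', herm_sub_left, herm_sub_left, herm_smul_left, herm_smul_left, hav, hbv,
        div_mul_cancel₀ _ hs]
      ring
    have hw'u : herm n w' u = 0 := by
      rw [hw', herm_sub_left, herm_sub_left, herm_smul_left, herm_smul_left, hau, hbu,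
        div_mul_cancel₀ _ hs]
      ring
    have hψw : ψ *ᵥ w' = ψ *ᵥ w := by
      rw [hw', Matrix.mulVec_sub, Matrix.mulVec_sub, Matrix.mulVec_smul, Matrix.mulVec_smul, hz,
        hzb, smul_zero, smul_zero, sub_zero, sub_zero]
    obtain ⟨z₁, hz₁⟩ := hc w' hw'v
    obtain ⟨z₂, hz₂⟩ := hc' w' hw'u
    have h : herm n (z₁ • v₀) a = herm n (z₂ • u) a := by rw [← hz₁, hz₂]
    rw [herm_smul_left, herm_smul_left, hva, hua, mul_zero] at h
    rw [← hψw, hz₁, (mul_eq_zero.mp h).resolve_right hs, zero_smul]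
  exact Matrix.mulVec_injective (funext fun w => by rw [hψ, Matrix.zero_mulVec])

end
end

section
/- Let n ≥ 1, let Ẽ := diag(1, 0, …, 0, −1) ∈ su(ℂ^{2n+4}, Q_{2n+2,2}) and set 𝔤̃_i := {Y ∈ su(ℂ^{2n+4}, Q_{2n+2,2}) : [Ẽ, Y] = i·Y} for i ∈ ℤ. Then su(ℂ^{2n+4}, Q_{2n+2,2}) = ⊕_{i=−2}^{2} 𝔤̃_i, and the graded embedding φ := (X ↦ Φ·ι_ℍ(X)·Φᵗ) of sp(ℍ^{n+1,1}) into su(ℂ^{2n+4}, Q_{2n+2,2}) satisfies, writing φ_i(X) for the component of φ(X) in 𝔤̃_i: (a) φ(X) = φ_{−1}(X) + φ_0(X) for every X ∈ 𝔤_{−1}, and φ(Z) = φ_0(Z) + φ_1(Z) for every Z ∈ 𝔤_1; (b) tr(φ_{−1}(X)·φ_1(Z)) = tr(φ_0(X)·φ_0(Z)) for all X ∈ 𝔤_{−1} and Z ∈ 𝔤_1; (c) writing P(p) ∈ 𝔤_{−2} for the element with (3,1)-block entry p̄ and Q(q) ∈ 𝔤_2 for the element with (1,3)-block entry q (p, q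 ∈ Im ℍ): φ(P(j)) ∈ 𝔤̃_{−1}, φ(P(k)) ∈ 𝔤̃_{−1} and φ(P(i)) = φ_{−2}(P(i)) + φ_0(P(i)); similarly φ(Q(j)), φ(Q(k)) ∈ 𝔤̃_1 and φ(Q(i)) = φ_0(Q(i)) + φ_2(Q(i)); (d) tr(φ_{−2}(P(i))·φ_2(Q(i))) = tr(φ_0(P(i))·φ_0(Q(i))). (These are the appendix verifications that the inclusion 𝔤^{qc} ⊂ 𝔤^{cr} satisfies the compatibility hypotheses of Lemmas 5.2 and 5.3.) -/
open Matrix Quaternion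

noncomputable section

/-- `Q_{2n+2,2}` as a complex matrix of size `2n+4`. -/
def QbigC (n : ℕ) : Matrix (Fin (2 * n + 4)) (Fin (2 * n + 4)) ℂ :=
  (Qmat (2 * n + 1) 1 : Matrix (Fin (2 * n + 4)) (Fin (2 * n + 4)) ℝ).map Complex.ofReal

/-- `Q_{n+1,1}` as a quaternionic matrix. -/
def Qq (n : ℕ) : Matrix (Fin (n + 2)) (Fin (n + 2)) ℍ[ℝ] :=
  (Qmat n 0).map (fun r => (r : ℍ[ℝ]))

/-- `X ∈ sp(ℍ^{n+1,1})`. -/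
def spCond (n : ℕ) (X : Matrix (Fin (n + 2)) (Fin (n + 2)) ℍ[ℝ]) : Prop :=
  Xᵀ * Qq n + Qq n * X.map star = 0

/-- The grading element `E = diag(1,0,…,0,−1)` of `sp(ℍ^{n+1,1})`. -/
def Emat (n : ℕ) : Matrix (Fin (n + 2)) (Fin (n + 2)) ℍ[ℝ] :=
  Matrix.diagonal fun i => if (i : ℕ) = 0 then 1 else if (i : ℕ) = n + 1 then -1 else 0

/-- `X ∈ 𝔤_d ⊆ sp(ℍ^{n+1,1})` (grading by `ad E`-eigenvalues). -/
def gq (n : ℕ) (d : ℤ) (X : Matrix (Fin (n + 2)) (Fin (n + 2)) ℍ[ℝ]) : Prop :=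
  spCond n X ∧ Emat n * X - X * Emat n = d • X

/-- `Y ∈ su(ℂ^{2n+4}, Q_{2n+2,2})`. -/
def suB (n : ℕ) (Y : Matrix (Fin (2 * n + 4)) (Fin (2 * n + 4)) ℂ) : Prop :=
  Yᵀ * QbigC n + QbigC n * Y.map (starRingEnd ℂ) = 0 ∧ Y.trace = 0

/-- The grading element `Ẽ := diag(1,0,…,0,−1)` of `su(ℂ^{2n+4}, Q_{2n+2,2})`. -/
def Et (n : ℕ) : Matrix (Fin (2 * n + 4)) (Fin (2 * n + 4)) ℂ :=
  Matrix.diagonal fun i => if (i : ℕ) = 0 then 1 else if (i : ℕ) = 2 * n + 3 then -1 else 0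

/-- `Y ∈ 𝔤̃_d ⊆ su(ℂ^{2n+4}, Q_{2n+2,2})`. -/
def gt (n : ℕ) (d : ℤ) (Y : Matrix (Fin (2 * n + 4)) (Fin (2 * n + 4)) ℂ) : Prop :=
  suB n Y ∧ Et n * Y - Y * Et n = d • Y

/-- The 0-based index permutation of the appendix. -/
def permFun (n : ℕ) (k : ℕ) : ℕ :=
  if k = 0 then 0
  else if k ≤ n then k + 1
  else if k = n + 1 then 2 * n + 3
  else if k = n + 2 then 1
  else if k ≤ 2 * n + 2 then k - 1
  else 2 * n + 2

/-- The change-of-basis (permutation) matrix `Φ` (complex entries). -/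
def PhiC (n : ℕ) : Matrix (Fin (2 * n + 4)) (Fin (2 * n + 4)) ℂ :=
  Matrix.of fun i k => if (i : ℕ) = permFun n (k : ℕ) then 1 else 0

def qc1 (x : ℍ[ℝ]) : ℂ := ⟨x.re, x.imI⟩
def qc2 (x : ℍ[ℝ]) : ℂ := ⟨x.imJ, -x.imK⟩

/-- `ι_ℍ : M_{n+2}(ℍ) → M_{2n+4}(ℂ)` in flattened (size `2n+4`) form. -/
def iotaH' (n : ℕ) (X : Matrix (Fin (n + 2)) (Fin (n + 2)) ℍ[ℝ]) :
    Matrix (Fin (2 * n + 4)) (Fin (2 * n + 4)) ℂ :=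
  Matrix.of fun i j =>
    if hi : (i : ℕ) < n + 2 then
      if hj : (j : ℕ) < n + 2 then qc1 (X ⟨i, hi⟩ ⟨j, hj⟩)
      else -(starRingEnd ℂ) (qc2 (X ⟨i, hi⟩ ⟨(j : ℕ) - (n + 2), by have := j.isLt; omega⟩))
    else
      if hj : (j : ℕ) < n + 2 then
        qc2 (X ⟨(i : ℕ) - (n + 2), by have := i.isLt; omega⟩ ⟨j, hj⟩)
      else (starRingEnd ℂ) (qc1 (X ⟨(i : ℕ) - (n + 2), by have := i.isLt; omega⟩
        ⟨(j : ℕ) - (n + 2), by have := j.isLt; omega⟩))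

/-- The graded embedding `φ : sp(ℍ^{n+1,1}) → su(ℂ^{2n+4}, Q_{2n+2,2})`,
`φ(X) = Φ·ι_ℍ(X)·Φᵗ`. -/
def phiMap (n : ℕ) (X : Matrix (Fin (n + 2)) (Fin (n + 2)) ℍ[ℝ]) :
    Matrix (Fin (2 * n + 4)) (Fin (2 * n + 4)) ℂ :=
  PhiC n * iotaH' n X * (PhiC n)ᵀ

/-- `P(p) ∈ 𝔤_{−2}`: the element with `(3,1)`-block entry `p̄`. -/
def Plow (n : ℕ) (p : ℍ[ℝ]) : Matrix (Fin (n + 2)) (Fin (n + 2)) ℍ[ℝ] :=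
  Matrix.of fun i j => if (i : ℕ) = n + 1 ∧ (j : ℕ) = 0 then star p else 0

/-- `Q(q) ∈ 𝔤_2`: the element with `(1,3)`-block entry `q`. -/
def Qhigh (n : ℕ) (q : ℍ[ℝ]) : Matrix (Fin (n + 2)) (Fin (n + 2)) ℍ[ℝ] :=
  Matrix.of fun i j => if (i : ℕ) = 0 ∧ (j : ℕ) = n + 1 then q else 0

/-- The quaternion units `i`, `j`, `k`. -/
def qi : ℍ[ℝ] := ⟨0, 1, 0, 0⟩
def qj : ℍ[ℝ] := ⟨0, 0, 1, 0⟩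
def qk : ℍ[ℝ] := ⟨0, 0, 0, 1⟩

/-- The eigenvalue of `E` on the `i`-th basis vector. -/
def wtQ (n : ℕ) (i : Fin (n + 2)) : ℤ :=
  if (i : ℕ) = 0 then 1 else if (i : ℕ) = n + 1 then -1 else 0

/-- The eigenvalue of `Ẽ` on the `i`-th basis vector. -/
def wtC (n : ℕ) (i : Fin (2 * n + 4)) : ℤ :=
  if (i : ℕ) = 0 then 1 else if (i : ℕ) = 2 * n + 3 then -1 else 0

/-- The involution of indices underlying `Q_{n+1,1}`. -/
def invQ (n : ℕ) (i : Fin (n + 2)) : Fin (n + 2) :=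
  if (i : ℕ) = 0 ∨ (i : ℕ) = n + 1 then ⟨n + 1 - i, by omega⟩ else i

/-- The involution of indices underlying `Q_{2n+2,2}`. -/
def invC (n : ℕ) (i : Fin (2 * n + 4)) : Fin (2 * n + 4) :=
  if (i : ℕ) ≤ 1 ∨ 2 * n + 2 ≤ (i : ℕ) then ⟨2 * n + 3 - i, by omega⟩ else i

lemma invQ_val (n : ℕ) (i : Fin (n + 2)) :
    (invQ n i : ℕ) = if (i : ℕ) = 0 ∨ (i : ℕ) = n + 1 then n + 1 - (i : ℕ) else i := by
  unfold invQ; split_ifs <;> rfl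

lemma invC_val (n : ℕ) (i : Fin (2 * n + 4)) :
    (invC n i : ℕ) = if (i : ℕ) ≤ 1 ∨ 2 * n + 2 ≤ (i : ℕ) then 2 * n + 3 - (i : ℕ) else i := by
  unfold invC; split_ifs <;> rfl

lemma invQ_involutive (n : ℕ) : Function.Involutive (invQ n) := by
  intro i
  apply Fin.ext
  have := i.isLt
  rw [invQ_val, invQ_val]
  split_ifs <;> omega

lemma invC_involutive (n : ℕ) : Function.Involutive (invC n) := by
  intro i
  apply Fin.ext
  have := i.isLt
  rw [invC_val, invC_val]
  split_ifs <;> omega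

lemma wtQ_invQ (n : ℕ) (i : Fin (n + 2)) : wtQ n (invQ n i) = -wtQ n i := by
  have := i.isLt
  unfold wtQ
  rw [invQ_val]
  split_ifs <;> omega

lemma wtC_invC (n : ℕ) (i : Fin (2 * n + 4)) : wtC n (invC n i) = -wtC n i := by
  have := i.isLt
  unfold wtC
  rw [invC_val]
  split_ifs <;> omega

lemma Emat_eq (n : ℕ) : Emat n = Matrix.diagonal fun i => (wtQ n i : ℍ[ℝ]) := by
  unfold Emat wtQ
  congr 1
  ext1 i
  split_ifs <;> simp

lemma Et_eq (n : ℕ) : Et n = Matrix.diagonal fun i => (wtC n i : ℂ) := by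
  unfold Et wtC
  congr 1
  ext1 i
  split_ifs <;> simp

lemma Qq_apply (n : ℕ) (i j : Fin (n + 2)) : Qq n i j = if j = invQ n i then 1 else 0 := by
  have hi := i.isLt
  have hj := j.isLt
  simp only [Qq, Qmat, Matrix.map_apply, Matrix.of_apply, Fin.ext_iff, invQ_val]
  split_ifs <;> first | (exfalso; omega) | simp

lemma QbigC_apply (n : ℕ) (i j : Fin (2 * n + 4)) :
    QbigC n i j = if j = invC n i then 1 else 0 := by
  have hi := i.isLt
  have hj := j.isLt
  have : QbigC n i j = ((Qmat (2 * n + 1) 1 i j : ℝ) : ℂ) := rfl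
  rw [this]
  simp only [Qmat, Matrix.of_apply, Fin.ext_iff, invC_val]
  split_ifs <;> first | (exfalso; omega) | simp

lemma spCond_iff (n : ℕ) (X : Matrix (Fin (n + 2)) (Fin (n + 2)) ℍ[ℝ]) :
    spCond n X ↔ ∀ i j, X (invQ n j) i + star (X (invQ n i) j) = 0 := by
  have key (j k : Fin (n + 2)) : j = invQ n k ↔ k = invQ n j :=
    ⟨fun h => by rw [h, invQ_involutive], fun h => by rw [h, invQ_involutive]⟩
  unfold spCond
  rw [← Matrix.ext_iff]
  refine forall_congr' fun i => forall_congr' fun j => ?_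
  have h1 : ∀ k, Qq n k j = if k = invQ n j then 1 else 0 := fun k => by
    rw [Qq_apply]; simp only [key j k]
  simp [Matrix.mul_apply, h1, Qq_apply n i]

lemma suB_iff (n : ℕ) (Y : Matrix (Fin (2 * n + 4)) (Fin (2 * n + 4)) ℂ) :
    suB n Y ↔ (∀ i j, Y (invC n j) i + (starRingEnd ℂ) (Y (invC n i) j) = 0) ∧ Y.trace = 0 := by
  have key (j k : Fin (2 * n + 4)) : j = invC n k ↔ k = invC n j :=
    ⟨fun h => by rw [h, invC_involutive], fun h => by rw [h, invC_involutive]⟩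
  unfold suB
  rw [← Matrix.ext_iff]
  refine and_congr_left fun _ => forall_congr' fun i => forall_congr' fun j => ?_
  have h1 : ∀ k, QbigC n k j = if k = invC n j then 1 else 0 := fun k => by
    rw [QbigC_apply]; simp only [key j k]
  simp [Matrix.mul_apply, h1, QbigC_apply n i]

lemma gq_iff (n : ℕ) (d : ℤ) (X : Matrix (Fin (n + 2)) (Fin (n + 2)) ℍ[ℝ]) :
    gq n d X ↔ spCond n X ∧ ∀ i j, X i j ≠ 0 → wtQ n i - wtQ n j = d := by
  have : CharZero ℍ[ℝ] := charZero_of_injective_algebraMap (algebraMap ℝ ℍ[ℝ]).injective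
  unfold gq
  rw [Emat_eq, ← Matrix.ext_iff]
  refine and_congr_right fun _ => forall_congr' fun i => forall_congr' fun j => ?_
  rw [Matrix.sub_apply, Matrix.diagonal_mul, Matrix.mul_diagonal, Matrix.smul_apply,
    zsmul_eq_mul, ← (Int.cast_commute (wtQ n j) (X i j)).eq, ← sub_mul, ← sub_eq_zero, ← sub_mul,
    ← Int.cast_sub, ← Int.cast_sub, mul_eq_zero, Int.cast_eq_zero, sub_eq_zero]
  tauto

lemma gt_iff (n : ℕ) (d : ℤ) (Y : Matrix (Fin (2 * n + 4)) (Fin (2 * n + 4)) ℂ) :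
    gt n d Y ↔ suB n Y ∧ ∀ i j, Y i j ≠ 0 → wtC n i - wtC n j = d := by
  unfold gt
  rw [Et_eq, ← Matrix.ext_iff]
  refine and_congr_right fun _ => forall_congr' fun i => forall_congr' fun j => ?_
  rw [Matrix.sub_apply, Matrix.diagonal_mul, Matrix.mul_diagonal, Matrix.smul_apply,
    zsmul_eq_mul, mul_comm (Y i j), ← sub_mul, ← sub_eq_zero, ← sub_mul,
    ← Int.cast_sub, ← Int.cast_sub, mul_eq_zero, Int.cast_eq_zero, sub_eq_zero]
  tauto

/-- The component of degree `d` of a matrix with respect to `ad Ẽ`. -/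
def gradedComp (n : ℕ) (d : ℤ) (Y : Matrix (Fin (2 * n + 4)) (Fin (2 * n + 4)) ℂ) :
    Matrix (Fin (2 * n + 4)) (Fin (2 * n + 4)) ℂ :=
  Matrix.of fun i j => if wtC n i - wtC n j = d then Y i j else 0

lemma gradedComp_apply (n : ℕ) (d : ℤ) (Y : Matrix (Fin (2 * n + 4)) (Fin (2 * n + 4)) ℂ)
    (i j : Fin (2 * n + 4)) :
    gradedComp n d Y i j = if wtC n i - wtC n j = d then Y i j else 0 := rfl

lemma gradedComp_add (n : ℕ) (d : ℤ) (Y Y' : Matrix (Fin (2 * n + 4)) (Fin (2 * n + 4)) ℂ) :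
    gradedComp n d (Y + Y') = gradedComp n d Y + gradedComp n d Y' := by
  ext i j
  simp only [gradedComp_apply, Matrix.add_apply]
  split_ifs <;> simp

lemma gradedComp_of_gt {n : ℕ} {d : ℤ} {Y : Matrix (Fin (2 * n + 4)) (Fin (2 * n + 4)) ℂ}
    (h : gt n d Y) (m : ℤ) : gradedComp n m Y = if d = m then Y else 0 := by
  ext i j
  have h' := ((gt_iff n d Y).1 h).2 i j
  rw [gradedComp_apply]
  by_cases h0 : Y i j = 0
  · split_ifs <;> simp [h0]
  · rw [h' h0]
    split_ifs <;> rfl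

lemma gt_gradedComp {n : ℕ} {Y : Matrix (Fin (2 * n + 4)) (Fin (2 * n + 4)) ℂ}
    (h : suB n Y) (d : ℤ) : gt n d (gradedComp n d Y) := by
  rw [suB_iff] at h
  refine (gt_iff n d _).2 ⟨(suB_iff n _).2 ⟨fun i j => ?_, ?_⟩, fun i j hij => ?_⟩
  · have hw : wtC n (invC n i) - wtC n j = wtC n (invC n j) - wtC n i := by
      rw [wtC_invC, wtC_invC]; ring
    rw [gradedComp_apply, gradedComp_apply, hw]
    split_ifs
    · exact h.1 i j
    · simp
  · have h2 := h.2
    simp only [Matrix.trace, Matrix.diag_apply, gradedComp_apply, sub_self] at h2 ⊢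
    split_ifs
    · exact h2
    · simp
  · by_contra hne
    exact hij (by rw [gradedComp_apply, if_neg hne])

lemma eq_gradedComp_add {n : ℕ} {Y : Matrix (Fin (2 * n + 4)) (Fin (2 * n + 4)) ℂ} {d e : ℤ}
    (hde : d ≠ e) (h : ∀ i j, Y i j ≠ 0 → wtC n i - wtC n j = d ∨ wtC n i - wtC n j = e) :
    Y = gradedComp n d Y + gradedComp n e Y := by
  ext i j
  rw [Matrix.add_apply, gradedComp_apply, gradedComp_apply]
  by_cases h0 : Y i j = 0
  · simp [h0]
  · rcases h i j h0 with h1 | h1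
    · rw [if_pos h1, if_neg (by omega), add_zero]
    · rw [if_neg (by omega), if_pos h1, zero_add]

lemma eq_sum_gradedComp (n : ℕ) (Y : Matrix (Fin (2 * n + 4)) (Fin (2 * n + 4)) ℂ) :
    Y = gradedComp n (-2) Y + gradedComp n (-1) Y + gradedComp n 0 Y + gradedComp n 1 Y
      + gradedComp n 2 Y := by
  have hw (i : Fin (2 * n + 4)) : wtC n i = -1 ∨ wtC n i = 0 ∨ wtC n i = 1 := by
    unfold wtC; split_ifs <;> simp
  ext i j
  simp only [Matrix.add_apply, gradedComp_apply]
  rcases hw i with h | h | h <;> rcases hw j with h' | h' | h' <;> simp [h, h']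

lemma eq_gradedComp_of_add {n : ℕ} {Y A B : Matrix (Fin (2 * n + 4)) (Fin (2 * n + 4)) ℂ}
    {d e : ℤ} (hde : d ≠ e) (hA : gt n d A) (hB : gt n e B) (h : Y = A + B) :
    A = gradedComp n d Y ∧ B = gradedComp n e Y := by
  rw [h, gradedComp_add, gradedComp_add, gradedComp_of_gt hA, gradedComp_of_gt hB,
    gradedComp_of_gt hA, gradedComp_of_gt hB]
  simp [hde, hde.symm]

lemma suB_Et (n : ℕ) : suB n (Et n) := by
  rw [suB_iff, Et_eq]
  refine ⟨fun i j => ?_, ?_⟩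
  · have key : invC n j = i ↔ invC n i = j :=
      ⟨fun h => by rw [← h, invC_involutive], fun h => by rw [← h, invC_involutive]⟩
    simp only [Matrix.diagonal_apply, key]
    split_ifs with h
    · rw [wtC_invC, wtC_invC, ← h, wtC_invC]
      simp
    · simp
  · rw [Matrix.trace_diagonal, ← Int.cast_sum, Int.cast_eq_zero]
    have h := Equiv.sum_comp (invC_involutive n).toPerm (wtC n)
    simp only [Function.Involutive.coe_toPerm, wtC_invC, Finset.sum_neg_distrib] at h
    omega

lemma permFun_lt (n k : ℕ) (hk : k < 2 * n + 4) : permFun n k < 2 * n + 4 := by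
  unfold permFun; split_ifs <;> omega

lemma permFun_inj (n k l : ℕ) (hk : k < 2 * n + 4) (hl : l < 2 * n + 4)
    (h : permFun n k = permFun n l) : k = l := by
  unfold permFun at h; split_ifs at h <;> omega

lemma phiMap_apply (n : ℕ) (X : Matrix (Fin (n + 2)) (Fin (n + 2)) ℍ[ℝ])
    (i j : Fin (2 * n + 4)) :
    phiMap n X ⟨permFun n i, permFun_lt n i i.isLt⟩ ⟨permFun n j, permFun_lt n j j.isLt⟩
      = iotaH' n X i j := by
  have h : ∀ k l : Fin (2 * n + 4), permFun n k = permFun n l ↔ k = l := fun k l =>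
    ⟨fun h => Fin.ext (permFun_inj n k l k.isLt l.isLt h), fun h => by rw [h]⟩
  simp [phiMap, PhiC, Matrix.mul_apply, h]

/-- The reindexing `Φ` of `ι_ℍ`, as an identification of two copies of the quaternionic index set
with the complex one. -/
def phiIdx (n : ℕ) : Fin (n + 2) ⊕ Fin (n + 2) → Fin (2 * n + 4)
  | .inl i => ⟨permFun n i, permFun_lt n i (by omega)⟩
  | .inr i => ⟨permFun n (n + 2 + i), permFun_lt n _ (by omega)⟩

lemma phiIdx_bijective (n : ℕ) : Function.Bijective (phiIdx n) := by
  rw [Fintype.bijective_iff_injective_and_card]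
  refine ⟨?_, by simp; ring⟩
  rintro (i | i) (j | j) h <;> have hi := i.isLt <;> have hj := j.isLt <;>
    have h' := permFun_inj n _ _ (by omega) (by omega) (congrArg Fin.val h)
  · rw [Fin.ext h']
  · omega
  · omega
  · rw [Fin.ext (Nat.add_left_cancel h')]

/-- `phiIdx` as an equivalence. -/
def phiEquiv (n : ℕ) : Fin (n + 2) ⊕ Fin (n + 2) ≃ Fin (2 * n + 4) :=
  Equiv.ofBijective (phiIdx n) (phiIdx_bijective n)

lemma wtC_inl (n : ℕ) (i : Fin (n + 2)) : wtC n (phiEquiv n (.inl i)) = wtQ n i := by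
  have := i.isLt
  simp only [phiEquiv, Equiv.ofBijective_apply, phiIdx, wtC, wtQ, permFun]
  grind

lemma wtC_inr (n : ℕ) (i : Fin (n + 2)) : wtC n (phiEquiv n (.inr i)) = 0 := by
  have := i.isLt
  simp only [phiEquiv, Equiv.ofBijective_apply, phiIdx, wtC, permFun]
  grind

lemma invC_inl (n : ℕ) (i : Fin (n + 2)) :
    invC n (phiEquiv n (.inl i)) = phiEquiv n (.inl (invQ n i)) := by
  have := i.isLt
  apply Fin.ext
  rw [invC_val]
  simp only [phiEquiv, Equiv.ofBijective_apply, phiIdx, permFun, invQ_val]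
  grind

lemma invC_inr (n : ℕ) (i : Fin (n + 2)) :
    invC n (phiEquiv n (.inr i)) = phiEquiv n (.inr (invQ n i)) := by
  have := i.isLt
  apply Fin.ext
  rw [invC_val]
  simp only [phiEquiv, Equiv.ofBijective_apply, phiIdx, permFun, invQ_val]
  grind

section blocks

variable (n : ℕ) (X : Matrix (Fin (n + 2)) (Fin (n + 2)) ℍ[ℝ]) (i j : Fin (n + 2))

lemma phiMap_inl_inl :
    phiMap n X (phiEquiv n (.inl i)) (phiEquiv n (.inl j)) = qc1 (X i j) := by
  refine (phiMap_apply n X ⟨i, by omega⟩ ⟨j, by omega⟩).trans ?_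
  simp [iotaH']

lemma phiMap_inl_inr :
    phiMap n X (phiEquiv n (.inl i)) (phiEquiv n (.inr j))
      = -(starRingEnd ℂ) (qc2 (X i j)) := by
  refine (phiMap_apply n X ⟨i, by omega⟩ ⟨n + 2 + j, by omega⟩).trans ?_
  simp [iotaH']

lemma phiMap_inr_inl :
    phiMap n X (phiEquiv n (.inr i)) (phiEquiv n (.inl j)) = qc2 (X i j) := by
  refine (phiMap_apply n X ⟨n + 2 + i, by omega⟩ ⟨j, by omega⟩).trans ?_
  simp [iotaH']

lemma phiMap_inr_inr :
    phiMap n X (phiEquiv n (.inr i)) (phiEquiv n (.inr j))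
      = (starRingEnd ℂ) (qc1 (X i j)) := by
  refine (phiMap_apply n X ⟨n + 2 + i, by omega⟩ ⟨n + 2 + j, by omega⟩).trans ?_
  simp [iotaH']

end blocks

lemma qc1_neg_star (x : ℍ[ℝ]) : qc1 (-star x) = -(starRingEnd ℂ) (qc1 x) := by
  apply Complex.ext <;> simp [qc1]

lemma qc2_neg_star (x : ℍ[ℝ]) : qc2 (-star x) = qc2 x := by
  apply Complex.ext <;> simp [qc2]

@[simp] lemma qc1_zero : qc1 0 = 0 := rfl

@[simp] lemma qc2_zero : qc2 0 = 0 := by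
  apply Complex.ext <;> simp [qc2]

lemma suB_phiMap {n : ℕ} {X : Matrix (Fin (n + 2)) (Fin (n + 2)) ℍ[ℝ]} (h : spCond n X) :
    suB n (phiMap n X) := by
  have hX : ∀ i j, X (invQ n j) i = -star (X (invQ n i) j) := fun i j =>
    eq_neg_of_add_eq_zero_left ((spCond_iff n X).1 h i j)
  have hY : ∀ i j, phiMap n X (invC n j) i + (starRingEnd ℂ) (phiMap n X (invC n i) j) = 0 := by
    intro a b
    obtain ⟨a, rfl⟩ := (phiEquiv n).surjective a
    obtain ⟨b, rfl⟩ := (phiEquiv n).surjective b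
    rcases a with i | i <;> rcases b with j | j <;>
      simp only [invC_inl, invC_inr, phiMap_inl_inl, phiMap_inl_inr, phiMap_inr_inl,
        phiMap_inr_inr] <;> rw [hX i j]
    · rw [qc1_neg_star]; ring
    · rw [qc2_neg_star]; simp
    · rw [qc2_neg_star]; simp
    · rw [qc1_neg_star]; simp
  refine (suB_iff n _).2 ⟨hY, ?_⟩
  have htr : (phiMap n X).trace = ∑ i, (qc1 (X i i) + (starRingEnd ℂ) (qc1 (X i i))) := by
    rw [Matrix.trace, ← Equiv.sum_comp (phiEquiv n), Fintype.sum_sum_type,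
      ← Finset.sum_add_distrib]
    simp only [Matrix.diag_apply, phiMap_inl_inl, phiMap_inr_inr]
  have hsum := Equiv.sum_comp (invQ_involutive n).toPerm fun i => qc1 (X i i)
  simp only [Function.Involutive.coe_toPerm] at hsum
  have hdiag : ∀ i, qc1 (X (invQ n i) (invQ n i)) = -(starRingEnd ℂ) (qc1 (X i i)) := fun i => by
    rw [hX, invQ_involutive, qc1_neg_star]
  simp only [hdiag, Finset.sum_neg_distrib] at hsum
  rw [htr, Finset.sum_add_distrib, ← hsum]
  ring

/-- The support of `φ(X)` for `X` homogeneous: the degrees of its nonzero entries. -/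
lemma phiMap_support {n : ℕ} {d : ℤ} {X : Matrix (Fin (n + 2)) (Fin (n + 2)) ℍ[ℝ]}
    (h : gq n d X) (S : ℤ → Prop)
    (h1 : ∀ i j, wtQ n i - wtQ n j = d → qc1 (X i j) ≠ 0 → S d ∧ S 0)
    (h2 : ∀ i j, wtQ n i - wtQ n j = d → qc2 (X i j) ≠ 0 → S (wtQ n i) ∧ S (-wtQ n j))
    (a b : Fin (2 * n + 4)) (hab : phiMap n X a b ≠ 0) : S (wtC n a - wtC n b) := by
  have hX := ((gq_iff n d X).1 h).2
  have g1 : ∀ i j, qc1 (X i j) ≠ 0 → wtQ n i - wtQ n j = d ∧ S d ∧ S 0 := fun i j hq => by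
    have := hX i j fun h0 => hq (by rw [h0, qc1_zero])
    exact ⟨this, h1 i j this hq⟩
  have g2 : ∀ i j, qc2 (X i j) ≠ 0 → S (wtQ n i) ∧ S (-wtQ n j) := fun i j hq =>
    h2 i j (hX i j fun h0 => hq (by rw [h0, qc2_zero])) hq
  obtain ⟨a, rfl⟩ := (phiEquiv n).surjective a
  obtain ⟨b, rfl⟩ := (phiEquiv n).surjective b
  rcases a with i | i <;> rcases b with j | j <;>
    simp only [wtC_inl, wtC_inr, phiMap_inl_inl, phiMap_inl_inr, phiMap_inr_inl,
        phiMap_inr_inr, ne_eq, neg_eq_zero, map_eq_zero, sub_zero, zero_sub] at hab ⊢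
  · rw [(g1 i j hab).1]; exact (g1 i j hab).2.1
  · exact (g2 i j hab).1
  · exact (g2 i j hab).2
  · exact (g1 i j hab).2.2

lemma trace_mul_eq_sum (n : ℕ) (A B : Matrix (Fin (2 * n + 4)) (Fin (2 * n + 4)) ℂ) :
    (A * B).trace = ∑ i, ∑ j,
      (A (phiEquiv n (.inl i)) (phiEquiv n (.inl j)) * B (phiEquiv n (.inl j)) (phiEquiv n (.inl i))
      + A (phiEquiv n (.inl i)) (phiEquiv n (.inr j)) * B (phiEquiv n (.inr j)) (phiEquiv n (.inl i))
      + A (phiEquiv n (.inr i)) (phiEquiv n (.inl j)) * B (phiEquiv n (.inl j)) (phiEquiv n (.inr i))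
      + A (phiEquiv n (.inr i)) (phiEquiv n (.inr j))
        * B (phiEquiv n (.inr j)) (phiEquiv n (.inr i))) := by
  simp only [Matrix.trace, Matrix.diag_apply, Matrix.mul_apply]
  rw [← Equiv.sum_comp (phiEquiv n)]
  simp only [← Equiv.sum_comp (phiEquiv n) fun j => A _ j * B j _, Fintype.sum_sum_type,
    Finset.sum_add_distrib]
  ring

lemma trace_gradedComp_phiMap {n : ℕ} {d : ℤ} (hd : d ≠ 0)
    {X Z : Matrix (Fin (n + 2)) (Fin (n + 2)) ℍ[ℝ]} (hX : gq n d X) (hZ : gq n (-d) Z) :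
    (gradedComp n d (phiMap n X) * gradedComp n (-d) (phiMap n Z)).trace
      = (gradedComp n 0 (phiMap n X) * gradedComp n 0 (phiMap n Z)).trace := by
  rw [gq_iff, spCond_iff] at hX hZ
  have flip : ∀ {W : Matrix (Fin (n + 2)) (Fin (n + 2)) ℍ[ℝ]},
      (∀ i j, W (invQ n j) i + star (W (invQ n i) j) = 0) →
      ∀ i j, W (invQ n j) (invQ n i) = -star (W i j) := fun hW i j => by
    have := hW (invQ n i) j
    rw [invQ_involutive] at this
    exact eq_neg_of_add_eq_zero_left this
  have sum_flip (F : Fin (n + 2) → Fin (n + 2) → ℂ) :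
      ∑ i, ∑ j, F (invQ n j) (invQ n i) = ∑ i, ∑ j, F i j := by
    rw [Finset.sum_comm]
    exact (Finset.sum_congr rfl fun j _ => Equiv.sum_comp (invQ_involutive n).toPerm _).trans
      (Equiv.sum_comp (invQ_involutive n).toPerm fun j => ∑ i, F j i)
  rw [trace_mul_eq_sum, trace_mul_eq_sum, ← sum_flip]
  refine Finset.sum_congr rfl fun i _ => Finset.sum_congr rfl fun j _ => ?_
  simp only [gradedComp_apply, wtC_inl, wtC_inr, phiMap_inl_inl, phiMap_inl_inr, phiMap_inr_inl,
    phiMap_inr_inr, wtQ_invQ, flip hX.1 i j, flip hZ.1 j i, qc1_neg_star, qc2_neg_star]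
  by_cases h0 : X i j = 0
  · simp [h0]
  · have hw := hX.2 i j h0
    have e1 : -wtQ n j - -wtQ n i = d := by omega
    have e2 : -wtQ n i - -wtQ n j = -d := by omega
    have e3 : -wtQ n j - 0 = d ↔ wtQ n i = 0 := by omega
    have e4 : 0 - -wtQ n j = -d ↔ wtQ n i = 0 := by omega
    have e5 : 0 - -wtQ n i = d ↔ wtQ n j = 0 := by omega
    have e6 : -wtQ n i - 0 = -d ↔ wtQ n j = 0 := by omega
    have e7 : wtQ n j - wtQ n i ≠ 0 := by omega
    simp only [hw, e1, e2, e3, e4, e5, e6, e7]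
    simp [hd, hd.symm]
    ring

lemma gq_Plow (n : ℕ) {p : ℍ[ℝ]} (hp : star p = -p) : gq n (-2) (Plow n p) := by
  refine (gq_iff n _ _).2 ⟨(spCond_iff n _).2 fun i j => ?_, fun i j h => ?_⟩
  · have h1 : ((invQ n j : ℕ) = n + 1 ∧ (i : ℕ) = 0) ↔ ((i : ℕ) = 0 ∧ (j : ℕ) = 0) := by
      rw [invQ_val]; grind
    have h2 : ((invQ n i : ℕ) = n + 1 ∧ (j : ℕ) = 0) ↔ ((i : ℕ) = 0 ∧ (j : ℕ) = 0) := by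
      rw [invQ_val]; grind
    simp only [Plow, Matrix.of_apply, h1, h2]
    split_ifs <;> simp [hp]
  · have hij : (i : ℕ) = n + 1 ∧ (j : ℕ) = 0 := by
      by_contra hne
      exact h (if_neg hne)
    simp [wtQ, hij.1, hij.2]

lemma gq_Qhigh (n : ℕ) {q : ℍ[ℝ]} (hq : star q = -q) : gq n 2 (Qhigh n q) := by
  refine (gq_iff n _ _).2 ⟨(spCond_iff n _).2 fun i j => ?_, fun i j h => ?_⟩
  · have h1 : ((invQ n j : ℕ) = 0 ∧ (i : ℕ) = n + 1) ↔ ((i : ℕ) = n + 1 ∧ (j : ℕ) = n + 1) := by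
      rw [invQ_val]; grind
    have h2 : ((invQ n i : ℕ) = 0 ∧ (j : ℕ) = n + 1) ↔ ((i : ℕ) = n + 1 ∧ (j : ℕ) = n + 1) := by
      rw [invQ_val]; grind
    simp only [Qhigh, Matrix.of_apply, h1, h2]
    split_ifs <;> simp [hq]
  · have hij : (i : ℕ) = 0 ∧ (j : ℕ) = n + 1 := by
      by_contra hne
      exact h (if_neg hne)
    simp [wtQ, hij.1, hij.2]

lemma wtQ_cases (n : ℕ) (i : Fin (n + 2)) : wtQ n i = -1 ∨ wtQ n i = 0 ∨ wtQ n i = 1 := by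
  unfold wtQ; split_ifs <;> simp

/-- An element of degree `±1` is mapped into degrees `±1` and `0`. -/
lemma exists_gt_add_of_gq_one {n : ℕ} {d : ℤ} (hd : d = 1 ∨ d = -1)
    {X : Matrix (Fin (n + 2)) (Fin (n + 2)) ℍ[ℝ]} (h : gq n d X) :
    ∃ Y Y0, gt n d Y ∧ gt n 0 Y0 ∧ phiMap n X = Y + Y0 := by
  have hs := suB_phiMap h.1
  refine ⟨_, _, gt_gradedComp hs d, gt_gradedComp hs 0, eq_gradedComp_add (by omega) ?_⟩
  refine phiMap_support h (fun m => m = d ∨ m = 0) (fun _ _ _ _ => ⟨.inl rfl, .inr rfl⟩) ?_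
  intro i j hij _
  have := wtQ_cases n i
  have := wtQ_cases n j
  omega

/-- An element of degree `±2` with entries in `ℂ` is mapped into degrees `±2` and `0`. -/
lemma exists_gt_add_of_gq_two {n : ℕ} {d : ℤ} (hd : d ≠ 0)
    {X : Matrix (Fin (n + 2)) (Fin (n + 2)) ℍ[ℝ]} (h : gq n d X) (hX : ∀ i j, qc2 (X i j) = 0) :
    ∃ Y Y0, gt n d Y ∧ gt n 0 Y0 ∧ phiMap n X = Y + Y0 := by
  have hs := suB_phiMap h.1
  refine ⟨_, _, gt_gradedComp hs d, gt_gradedComp hs 0, eq_gradedComp_add hd ?_⟩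
  exact phiMap_support h (fun m => m = d ∨ m = 0) (fun _ _ _ _ => ⟨.inl rfl, .inr rfl⟩)
    fun i j _ hq => absurd (hX i j) hq

/-- An element of degree `2e = ±2` with entries in `jℂ` is mapped into degree `e`. -/
lemma gt_phiMap_of_gq_two {n : ℕ} {d e : ℤ} (he : e = 1 ∨ e = -1) (hd : d = 2 * e)
    {X : Matrix (Fin (n + 2)) (Fin (n + 2)) ℍ[ℝ]} (h : gq n d X) (hX : ∀ i j, qc1 (X i j) = 0) :
    gt n e (phiMap n X) := by
  refine (gt_iff n _ _).2 ⟨suB_phiMap h.1, ?_⟩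
  refine phiMap_support h (fun m => m = e) (fun i j _ hq => absurd (hX i j) hq) ?_
  intro i j hij _
  have := wtQ_cases n i
  have := wtQ_cases n j
  omega

lemma star_qi : star qi = -qi := by
  ext <;> simp <;> simp [qi]

lemma star_qj : star qj = -qj := by
  ext <;> simp <;> simp [qj]

lemma star_qk : star qk = -qk := by
  ext <;> simp <;> simp [qk]

lemma map_Plow_eq_zero (n : ℕ) {p : ℍ[ℝ]} {f : ℍ[ℝ] → ℂ} (h0 : f 0 = 0) (hp : f (star p) = 0)
    (i j : Fin (n + 2)) : f (Plow n p i j) = 0 := by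
  simp only [Plow, Matrix.of_apply]
  split_ifs <;> assumption

lemma map_Qhigh_eq_zero (n : ℕ) {q : ℍ[ℝ]} {f : ℍ[ℝ] → ℂ} (h0 : f 0 = 0) (hq : f q = 0)
    (i j : Fin (n + 2)) : f (Qhigh n q i j) = 0 := by
  simp only [Qhigh, Matrix.of_apply]
  split_ifs <;> assumption

/-- the appendix verifications that `𝔤^{qc} ⊂ 𝔤^{cr}` satisfies the
compatibility hypotheses of Lemmas 5.2 and 5.3. -/
theorem qc_fefferman_stmt15 (n : ℕ) (hn : 1 ≤ n) :
    -- `Ẽ ∈ su(ℂ^{2n+4}, Q_{2n+2,2})` and `su = ⊕_{i=-2}^{2} 𝔤̃_i`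
    suB n (Et n) ∧
    (∀ Y, suB n Y → ∃ Yc : ℤ → Matrix (Fin (2 * n + 4)) (Fin (2 * n + 4)) ℂ,
      (∀ i : ℤ, gt n i (Yc i)) ∧
      Y = Yc (-2) + Yc (-1) + Yc 0 + Yc 1 + Yc 2) ∧
    (∀ Yc : ℤ → Matrix (Fin (2 * n + 4)) (Fin (2 * n + 4)) ℂ,
      (∀ i : ℤ, gt n i (Yc i)) →
      Yc (-2) + Yc (-1) + Yc 0 + Yc 1 + Yc 2 = 0 →
      Yc (-2) = 0 ∧ Yc (-1) = 0 ∧ Yc 0 = 0 ∧ Yc 1 = 0 ∧ Yc 2 = 0) ∧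
    -- (a) `φ(X) = φ_{−1}(X) + φ₀(X)` for `X ∈ 𝔤_{−1}`, and
    --     `φ(Z) = φ₀(Z) + φ₁(Z)` for `Z ∈ 𝔤_1`
    (∀ X, gq n (-1) X → ∃ Ym Y0, gt n (-1) Ym ∧ gt n 0 Y0 ∧ phiMap n X = Ym + Y0) ∧
    (∀ Z, gq n 1 Z → ∃ Y0 Yp, gt n 0 Y0 ∧ gt n 1 Yp ∧ phiMap n Z = Y0 + Yp) ∧
    -- (b) `tr(φ_{−1}(X)·φ_1(Z)) = tr(φ₀(X)·φ₀(Z))`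
    (∀ X Z Ym Y0 Y0' Yp, gq n (-1) X → gq n 1 Z →
      gt n (-1) Ym → gt n 0 Y0 → phiMap n X = Ym + Y0 →
      gt n 0 Y0' → gt n 1 Yp → phiMap n Z = Y0' + Yp →
      (Ym * Yp).trace = (Y0 * Y0').trace) ∧
    -- (c) the images of `P(j)`, `P(k)` lie in `𝔤̃_{−1}`, and
    --     `φ(P(i)) = φ_{−2}(P(i)) + φ₀(P(i))`; dually for `Q(·)`
    gt n (-1) (phiMap n (Plow n qj)) ∧
    gt n (-1) (phiMap n (Plow n qk)) ∧
    (∃ Ym2 Y0, gt n (-2) Ym2 ∧ gt n 0 Y0 ∧ phiMap n (Plow n qi) = Ym2 + Y0) ∧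
    gt n 1 (phiMap n (Qhigh n qj)) ∧
    gt n 1 (phiMap n (Qhigh n qk)) ∧
    (∃ Y0 Yp2, gt n 0 Y0 ∧ gt n 2 Yp2 ∧ phiMap n (Qhigh n qi) = Y0 + Yp2) ∧
    -- (d) `tr(φ_{−2}(P(i))·φ_2(Q(i))) = tr(φ₀(P(i))·φ₀(Q(i)))`
    (∀ Ym2 Y0 Y0' Yp2, gt n (-2) Ym2 → gt n 0 Y0 → phiMap n (Plow n qi) = Ym2 + Y0 →
      gt n 0 Y0' → gt n 2 Yp2 → phiMap n (Qhigh n qi) = Y0' + Yp2 →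
      (Ym2 * Yp2).trace = (Y0 * Y0').trace) := by
  have hPi := gq_Plow n star_qi
  have hQi := gq_Qhigh n star_qi
  refine ⟨suB_Et n, fun Y hY => ⟨fun i => gradedComp n i Y, fun i => gt_gradedComp hY i,
    eq_sum_gradedComp n Y⟩, fun Yc hYc hsum => ?_, fun X hX => exists_gt_add_of_gq_one (.inr rfl) hX,
    fun Z hZ => ?_, ?_,
    gt_phiMap_of_gq_two (.inr rfl) (by norm_num) (gq_Plow n star_qj)
      (map_Plow_eq_zero n qc1_zero ?_),
    gt_phiMap_of_gq_two (.inr rfl) (by norm_num) (gq_Plow n star_qk)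
      (map_Plow_eq_zero n qc1_zero ?_),
    exists_gt_add_of_gq_two (by norm_num) hPi (map_Plow_eq_zero n qc2_zero ?_),
    gt_phiMap_of_gq_two (.inl rfl) (by norm_num) (gq_Qhigh n star_qj)
      (map_Qhigh_eq_zero n qc1_zero ?_),
    gt_phiMap_of_gq_two (.inl rfl) (by norm_num) (gq_Qhigh n star_qk)
      (map_Qhigh_eq_zero n qc1_zero ?_), ?_, ?_⟩
  · have h (m : ℤ) := congrArg (gradedComp n m) hsum
    have hz (m : ℤ) : gradedComp n m 0 = 0 := by ext; simp [gradedComp_apply]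
    simp only [gradedComp_add, gradedComp_of_gt (hYc _), hz] at h
    exact ⟨by simpa using h (-2), by simpa using h (-1), by simpa using h 0, by simpa using h 1,
      by simpa using h 2⟩
  · obtain ⟨Y, Y0, hY, hY0, h⟩ := exists_gt_add_of_gq_one (.inl rfl) hZ
    exact ⟨Y0, Y, hY0, hY, h.trans (add_comm _ _)⟩
  · intro X Z Ym Y0 Y0' Yp hX hZ hYm hY0 h hY0' hYp h'
    obtain ⟨rfl, rfl⟩ := eq_gradedComp_of_add (by norm_num) hYm hY0 h
    obtain ⟨rfl, rfl⟩ := eq_gradedComp_of_add (by norm_num) hY0' hYp h'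
    exact trace_gradedComp_phiMap (d := -1) (by norm_num) hX hZ
  · apply Complex.ext <;> simp [qc1] <;> simp [qj]
  · apply Complex.ext <;> simp [qc1] <;> simp [qk]
  · apply Complex.ext <;> simp [qc2] <;> simp [qi]
  · apply Complex.ext <;> simp [qc1] <;> simp [qj]
  · apply Complex.ext <;> simp [qc1] <;> simp [qk]
  · obtain ⟨Y, Y0, hY, hY0, h⟩ := exists_gt_add_of_gq_two (by norm_num) hQi
      (map_Qhigh_eq_zero n qc2_zero (by apply Complex.ext <;> simp [qc2] <;> simp [qi]))
    exact ⟨Y0, Y, hY0, hY, h.trans (add_comm _ _)⟩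
  · intro Ym2 Y0 Y0' Yp2 hYm hY0 h hY0' hYp h'
    obtain ⟨rfl, rfl⟩ := eq_gradedComp_of_add (by norm_num) hYm hY0 h
    obtain ⟨rfl, rfl⟩ := eq_gradedComp_of_add (by norm_num) hY0' hYp h'
    exact trace_gradedComp_phiMap (d := -2) (by norm_num) hPi hQi


end
end
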